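/- Progress for channels with continuation: suppose Γ ⇒ C[x̄⟨u⟩v]:F, t₁:F₁, …, tₙ:Fₙ, t_{n+1}, …, t_m is derivable in NMLL, where C[ ] is a context. Then the term C[x̄⟨u⟩v] ∣ t₁ ∣ … ∣ t_m is not normal, i.e., some reduction rule of λ∥ applies to it. -/

import Mathlib

/- Types of multiplicative linear logic: propositional variables, ⊥, ⊸, ⅋ -/
inductive Ty : Type
  | pvar : ℕ → Ty
  | bot : Ty
  | limp : Ty → Ty → Ty
  | parr : Ty → Ty → Ty
  deriving DecidableEq

/- Untyped terms of λ∥ -/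
inductive Tm : Type
  | unit : Tm                    -- ∘ (terminated process)
  | out : ℕ → Tm → Tm            -- x̄ u (output channel with continuation; λx u when x occurs in u)
  | out2 : ℕ → ℕ → Tm → Tm       -- x̄ȳ u (output channels without continuation)
  | par : Tm → Tm → Tm           -- u ∣ v
  | close : Tm → Tm              -- close(u)
  | var : ℕ → Tm                 -- variable x
  | app : Tm → Tm → Tm           -- application u v
  deriving DecidableEq

namespace Tm

/-- number of occurrences of the variable (input channel) x in a term -/
def varOcc (x : ℕ) : Tm → ℕ
  | unit => 0
  | out _ u => varOcc x u
  | out2 _ _ u => varOcc x u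
  | par u v => varOcc x u + varOcc x v
  | close u => varOcc x u
  | var y => if y = x then 1 else 0
  | app u v => varOcc x u + varOcc x v

/-- number of occurrences of the output binder x̄ in a term -/
def outOcc (x : ℕ) : Tm → ℕ
  | unit => 0
  | out y u => (if y = x then 1 else 0) + outOcc x u
  | out2 y z u => (if y = x then 1 else 0) + (if z = x then 1 else 0) + outOcc x u
  | par u v => outOcc x u + outOcc x v
  | close u => outOcc x u
  | var _ => 0
  | app u v => outOcc x u + outOcc x v

/-- literal substitution of the term v for the variable x (no renaming) -/
def subst (x : ℕ) (v : Tm) : Tm → Tm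
  | unit => unit
  | out y u => out y (subst x v u)
  | out2 y z u => out2 y z (subst x v u)
  | par u w => par (subst x v u) (subst x v w)
  | close u => close (subst x v u)
  | var y => if y = x then v else var y
  | app u w => app (subst x v u) (subst x v w)

/-- communication-size: number of occurrences of the operators x̄ and x̄ȳ -/
def cs : Tm → ℕ
  | unit => 0
  | out _ u => cs u + 1
  | out2 _ _ u => cs u + 1
  | par u v => cs u + cs v
  | close u => cs u
  | var _ => 0
  | app u v => cs u + cs v

/-- values: terms of the form x̄ t or s ∣ t -/
def IsValue : Tm → Prop
  | out _ _ => True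
  | par _ _ => True
  | _ => False

end Tm

/- one-hole contexts -/
inductive Ctx : Type
  | hole : Ctx
  | out : ℕ → Ctx → Ctx
  | out2 : ℕ → ℕ → Ctx → Ctx
  | parL : Ctx → Tm → Ctx
  | parR : Tm → Ctx → Ctx
  | close : Ctx → Ctx
  | appL : Ctx → Tm → Ctx
  | appR : Tm → Ctx → Ctx

namespace Ctx

def fill : Ctx → Tm → Tm
  | hole, t => t
  | out x C, t => Tm.out x (fill C t)
  | out2 x y C, t => Tm.out2 x y (fill C t)
  | parL C u, t => Tm.par (fill C t) u
  | parR u C, t => Tm.par u (fill C t)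
  | close C, t => Tm.close (fill C t)
  | appL C u, t => Tm.app (fill C t) u
  | appR u C, t => Tm.app u (fill C t)

/-- a context is simple if it has no subterm of the form D[ ]∣u or u∣D[ ] -/
def Simple : Ctx → Prop
  | hole => True
  | out _ C => Simple C
  | out2 _ _ C => Simple C
  | parL _ _ => False
  | parR _ _ => False
  | close C => Simple C
  | appL C _ => Simple C
  | appR _ C => Simple C

/-- occurrences of the variable x in the context (not counting the hole) -/
def varOcc (x : ℕ) : Ctx → ℕ
  | hole => 0
  | out _ C => varOcc x C
  | out2 _ _ C => varOcc x C
  | parL C u => varOcc x C + Tm.varOcc x u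
  | parR u C => Tm.varOcc x u + varOcc x C
  | close C => varOcc x C
  | appL C u => varOcc x C + Tm.varOcc x u
  | appR u C => Tm.varOcc x u + varOcc x C

end Ctx

/- two-hole contexts D[ ][ ] -/
inductive Ctx2 : Type
  | out : ℕ → Ctx2 → Ctx2
  | out2 : ℕ → ℕ → Ctx2 → Ctx2
  | close : Ctx2 → Ctx2
  | parLL : Ctx2 → Tm → Ctx2
  | parRR : Tm → Ctx2 → Ctx2
  | parLR : Ctx → Ctx → Ctx2
  | parRL : Ctx → Ctx → Ctx2
  | appLL : Ctx2 → Tm → Ctx2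
  | appRR : Tm → Ctx2 → Ctx2
  | appLR : Ctx → Ctx → Ctx2
  | appRL : Ctx → Ctx → Ctx2

def Ctx2.fill : Ctx2 → Tm → Tm → Tm
  | .out x C, a, b => Tm.out x (Ctx2.fill C a b)
  | .out2 x y C, a, b => Tm.out2 x y (Ctx2.fill C a b)
  | .close C, a, b => Tm.close (Ctx2.fill C a b)
  | .parLL C u, a, b => Tm.par (Ctx2.fill C a b) u
  | .parRR u C, a, b => Tm.par u (Ctx2.fill C a b)
  | .parLR C D, a, b => Tm.par (Ctx.fill C a) (Ctx.fill D b)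
  | .parRL C D, a, b => Tm.par (Ctx.fill C b) (Ctx.fill D a)
  | .appLL C u, a, b => Tm.app (Ctx2.fill C a b) u
  | .appRR u C, a, b => Tm.app u (Ctx2.fill C a b)
  | .appLR C D, a, b => Tm.app (Ctx.fill C a) (Ctx.fill D b)
  | .appRL C D, a, b => Tm.app (Ctx.fill C b) (Ctx.fill D a)

/- one-step reduction of λ∥ -/
inductive Step : Tm → Tm → Prop
  /- β-reduction (λx u)t ↦ u[t/x], where λx u is x̄u with x occurring in u -/
  | beta (x : ℕ) (u t : Tm) (hx : 0 < Tm.varOcc x u) :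
      Step (Tm.app (Tm.out x u) t) (Tm.subst x t u)
  /- communication C[x̄⟨s⟩u] ∣ D[x] ↦ C[s] ∣ D[u] -/
  | comm1 (C D : Ctx) (x : ℕ) (s u : Tm) :
      Step (Tm.par (C.fill (Tm.app (Tm.out x s) u)) (D.fill (Tm.var x)))
           (Tm.par (C.fill s) (D.fill u))
  /- communication C[x] ∣ D[x̄⟨s⟩u] ↦ C[u] ∣ D[s] -/
  | comm2 (C D : Ctx) (x : ℕ) (s u : Tm) :
      Step (Tm.par (C.fill (Tm.var x)) (D.fill (Tm.app (Tm.out x s) u)))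
           (Tm.par (C.fill u) (D.fill s))
  /- C[x̄ȳ(s∣t)] ∣ D[x][y] ↦ C[∘] ∣ D[s][t] -/
  | pa1 (C : Ctx) (D : Ctx2) (x y : ℕ) (s t : Tm) :
      Step (Tm.par (C.fill (Tm.out2 x y (Tm.par s t))) (D.fill (Tm.var x) (Tm.var y)))
           (Tm.par (C.fill Tm.unit) (D.fill s t))
  /- D[x][y] ∣ C[x̄ȳ(s∣t)] ↦ D[s][t] ∣ C[∘] -/
  | pa2 (C : Ctx) (D : Ctx2) (x y : ℕ) (s t : Tm) :
      Step (Tm.par (D.fill (Tm.var x) (Tm.var y)) (C.fill (Tm.out2 x y (Tm.par s t))))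
           (Tm.par (D.fill s t) (C.fill Tm.unit))
  /- D[x] ∣ C[x̄ȳ(s∣t)] ∣ E[y] ↦ D[s] ∣ C[∘] ∣ E[t]  (both associations) -/
  | pa3l (C D E : Ctx) (x y : ℕ) (s t : Tm) :
      Step (Tm.par (Tm.par (D.fill (Tm.var x)) (C.fill (Tm.out2 x y (Tm.par s t)))) (E.fill (Tm.var y)))
           (Tm.par (Tm.par (D.fill s) (C.fill Tm.unit)) (E.fill t))
  | pa3r (C D E : Ctx) (x y : ℕ) (s t : Tm) :
      Step (Tm.par (D.fill (Tm.var x)) (Tm.par (C.fill (Tm.out2 x y (Tm.par s t))) (E.fill (Tm.var y))))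
           (Tm.par (D.fill s) (Tm.par (C.fill Tm.unit) (E.fill t)))
  /- D[y] ∣ C[x̄ȳ(s∣t)] ∣ E[x] ↦ D[t] ∣ C[∘] ∣ E[s]  (both associations) -/
  | pa4l (C D E : Ctx) (x y : ℕ) (s t : Tm) :
      Step (Tm.par (Tm.par (D.fill (Tm.var y)) (C.fill (Tm.out2 x y (Tm.par s t)))) (E.fill (Tm.var x)))
           (Tm.par (Tm.par (D.fill t) (C.fill Tm.unit)) (E.fill s))
  | pa4r (C D E : Ctx) (x y : ℕ) (s t : Tm) :
      Step (Tm.par (D.fill (Tm.var y)) (Tm.par (C.fill (Tm.out2 x y (Tm.par s t))) (E.fill (Tm.var x))))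
           (Tm.par (D.fill t) (Tm.par (C.fill Tm.unit) (E.fill s)))
  /- closure under arbitrary contexts -/
  | ctx (C : Ctx) {t u : Tm} (h : Step t u) : Step (C.fill t) (C.fill u)

/-- a term is normal if no reduction applies to it -/
def NormalTm (t : Tm) : Prop := ∀ u, ¬ Step t u

/-- parallel composition t₁ ∣ … ∣ tₘ of a list of terms -/
def bigPar : List Tm → Tm
  | [] => Tm.unit
  | t :: ts => ts.foldl Tm.par t

/- entries of the right-hand side of an NMLL sequent: a term with an optional type -/
abbrev Entry := Tm × Option Ty

/-- the variable z is used in the sequent Γ ⇒ Δ (declared in Γ, or occurring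
    as a variable or as an output binder in a term of Δ) -/
def UsedIn (Γ : Multiset (ℕ × Ty)) (Δ : Multiset Entry) (z : ℕ) : Prop :=
  (∃ A, (z, A) ∈ Γ) ∨ ∃ e ∈ Δ, 0 < Tm.varOcc z e.1 ∨ 0 < Tm.outOcc z e.1

/-- two sequents share no variable -/
def SeqDisj (Γ₁ : Multiset (ℕ × Ty)) (Δ₁ : Multiset Entry)
    (Γ₂ : Multiset (ℕ × Ty)) (Δ₂ : Multiset Entry) : Prop :=
  ∀ z, ¬ (UsedIn Γ₁ Δ₁ z ∧ UsedIn Γ₂ Δ₂ z)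

/- the multiple-conclusion natural deduction typing system NMLL -/
inductive NMLL : Multiset (ℕ × Ty) → Multiset Entry → Type
  | ax (x : ℕ) (A : Ty) : NMLL {(x, A)} {(Tm.var x, some A)}
  /- ⊸I (both variants: x occurs in t, or x occurs in Δ) -/
  | limpI {Γ : Multiset (ℕ × Ty)} {Δ : Multiset Entry} (x : ℕ) (A B : Ty) (t : Tm)
      (d : NMLL ((x, A) ::ₘ Γ) ((t, some B) ::ₘ Δ))
      (hx : 0 < Tm.varOcc x t ∨ ∃ e ∈ Δ, 0 < Tm.varOcc x e.1) :
      NMLL Γ ((Tm.out x t, some (Ty.limp A B)) ::ₘ Δ)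
  /- ⊸E -/
  | limpE {Γ Φ : Multiset (ℕ × Ty)} {Δ Θ : Multiset Entry} (s t : Tm) (A B : Ty)
      (d1 : NMLL Γ ((s, some (Ty.limp A B)) ::ₘ Δ))
      (d2 : NMLL Φ ((t, some A) ::ₘ Θ))
      (h : SeqDisj Γ ((s, some (Ty.limp A B)) ::ₘ Δ) Φ ((t, some A) ::ₘ Θ)) :
      NMLL (Γ + Φ) ((Tm.app s t, some B) ::ₘ (Δ + Θ))
  /- ⅋I -/
  | parrI {Γ : Multiset (ℕ × Ty)} {Δ : Multiset Entry} (s t : Tm) (A B : Ty)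
      (d : NMLL Γ ((s, some A) ::ₘ (t, some B) ::ₘ Δ)) :
      NMLL Γ ((Tm.par s t, some (Ty.parr A B)) ::ₘ Δ)
  /- ⅋E -/
  | parrE {Γ Φ₁ Φ₂ : Multiset (ℕ × Ty)} {Δ Θ₁ Θ₂ : Multiset Entry}
      (s : Tm) (x y : ℕ) (A B : Ty)
      (d1 : NMLL Γ ((s, some (Ty.parr A B)) ::ₘ Δ))
      (d2 : NMLL ((x, A) ::ₘ Φ₁) Θ₁)
      (d3 : NMLL ((y, B) ::ₘ Φ₂) Θ₂)
      (h12 : SeqDisj Γ ((s, some (Ty.parr A B)) ::ₘ Δ) ((x, A) ::ₘ Φ₁) Θ₁)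
      (h13 : SeqDisj Γ ((s, some (Ty.parr A B)) ::ₘ Δ) ((y, B) ::ₘ Φ₂) Θ₂)
      (h23 : SeqDisj ((x, A) ::ₘ Φ₁) Θ₁ ((y, B) ::ₘ Φ₂) Θ₂) :
      NMLL (Γ + Φ₁ + Φ₂) ((Tm.out2 x y s, some Ty.bot) ::ₘ (Δ + Θ₁ + Θ₂))
  /- ⊥I -/
  | botI {Γ : Multiset (ℕ × Ty)} {Δ : Multiset Entry} (d : NMLL Γ Δ) :
      NMLL Γ ((Tm.unit, some Ty.bot) ::ₘ Δ)
  /- ⊥E -/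
  | botE {Γ : Multiset (ℕ × Ty)} {Δ : Multiset Entry} (t : Tm)
      (d : NMLL Γ ((t, some Ty.bot) ::ₘ Δ)) :
      NMLL Γ ((Tm.close t, none) ::ₘ Δ)

/- the two-sided sequent calculus MLL for classical multiplicative linear logic -/
inductive MLL : Multiset Ty → Multiset Ty → Prop
  | ax (A : Ty) : MLL {A} {A}
  | botL : MLL {Ty.bot} 0
  | botR {Γ Δ : Multiset Ty} (h : MLL Γ Δ) : MLL Γ (Ty.bot ::ₘ Δ)
  | limpL {Γ Φ Δ Θ : Multiset Ty} {A B : Ty}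
      (h1 : MLL Γ (A ::ₘ Δ)) (h2 : MLL (B ::ₘ Φ) Θ) :
      MLL (Ty.limp A B ::ₘ (Γ + Φ)) (Δ + Θ)
  | limpR {Γ Δ : Multiset Ty} {A B : Ty} (h : MLL (A ::ₘ Γ) (B ::ₘ Δ)) :
      MLL Γ (Ty.limp A B ::ₘ Δ)
  | parrL {Γ Φ Δ Θ : Multiset Ty} {A B : Ty}
      (h1 : MLL (A ::ₘ Γ) Δ) (h2 : MLL (B ::ₘ Φ) Θ) :
      MLL (Ty.parr A B ::ₘ (Γ + Φ)) (Δ + Θ)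
  | parrR {Γ Δ : Multiset Ty} {A B : Ty} (h : MLL Γ (A ::ₘ B ::ₘ Δ)) :
      MLL Γ (Ty.parr A B ::ₘ Δ)
  | cut {Γ Φ Δ Θ : Multiset Ty} {A : Ty}
      (h1 : MLL Γ (A ::ₘ Δ)) (h2 : MLL (A ::ₘ Φ) Θ) :
      MLL (Γ + Φ) (Δ + Θ)

/-- the subformula relation on types (reflexive-transitive closure of immediate subformula) -/
inductive Subformula : Ty → Ty → Prop
  | refl (A : Ty) : Subformula A A
  | limpL {S A B : Ty} (h : Subformula S A) : Subformula S (Ty.limp A B)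
  | limpR {S A B : Ty} (h : Subformula S B) : Subformula S (Ty.limp A B)
  | parrL {S A B : Ty} (h : Subformula S A) : Subformula S (Ty.parr A B)
  | parrR {S A B : Ty} (h : Subformula S B) : Subformula S (Ty.parr A B)

/-- the types occurring in a sequent -/
def seqTys (Γ : Multiset (ℕ × Ty)) (Δ : Multiset Entry) : Multiset Ty :=
  Γ.map Prod.snd + Δ.filterMap Prod.snd

/-- all types occurring (in some sequent) in a derivation -/
def NMLL.tys : {Γ : Multiset (ℕ × Ty)} → {Δ : Multiset Entry} → NMLL Γ Δ → Multiset Ty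
  | _, _, @NMLL.ax x A => seqTys {(x, A)} {(Tm.var x, some A)}
  | _, _, @NMLL.limpI Γ Δ x A B t d _ =>
      seqTys Γ ((Tm.out x t, some (Ty.limp A B)) ::ₘ Δ) + d.tys
  | _, _, @NMLL.limpE Γ Φ Δ Θ s t A B d1 d2 _ =>
      seqTys (Γ + Φ) ((Tm.app s t, some B) ::ₘ (Δ + Θ)) + d1.tys + d2.tys
  | _, _, @NMLL.parrI Γ Δ s t A B d =>
      seqTys Γ ((Tm.par s t, some (Ty.parr A B)) ::ₘ Δ) + d.tys
  | _, _, @NMLL.parrE Γ Φ₁ Φ₂ Δ Θ₁ Θ₂ s x y A B d1 d2 d3 _ _ _ =>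
      seqTys (Γ + Φ₁ + Φ₂) ((Tm.out2 x y s, some Ty.bot) ::ₘ (Δ + Θ₁ + Θ₂))
        + d1.tys + d2.tys + d3.tys
  | _, _, @NMLL.botI Γ Δ d => seqTys Γ ((Tm.unit, some Ty.bot) ::ₘ Δ) + d.tys
  | _, _, @NMLL.botE Γ Δ t d => seqTys Γ ((Tm.close t, none) ::ₘ Δ) + d.tys

/-- total number of occurrences of the variable x in the terms of Δ -/
def varOccM (x : ℕ) (Δ : Multiset Entry) : ℕ := (Δ.map (fun e => Tm.varOcc x e.1)).sum

/-- total number of occurrences of the output binder x̄ in the terms of Δ -/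
def outOccM (x : ℕ) (Δ : Multiset Entry) : ℕ := (Δ.map (fun e => Tm.outOcc x e.1)).sum

/-- the term t contains an output with continuation x̄⟨u⟩v as a subterm -/
def HasOutput (x : ℕ) (t : Tm) : Prop :=
  ∃ (C : Ctx) (u v : Tm), t = C.fill (Tm.app (Tm.out x u) v)

/-- some reduction rule applies to the term -/
def Reducible (t : Tm) : Prop := ∃ w, Step t w

theorem Reducible.fill {t : Tm} (C : Ctx) : Reducible t → Reducible (C.fill t)
  | ⟨_, h⟩ => ⟨_, Step.ctx C h⟩

theorem exists_fill_var_of_varOcc_pos (x : ℕ) :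
    ∀ t : Tm, 0 < Tm.varOcc x t → ∃ D : Ctx, t = D.fill (Tm.var x)
  | .unit, h => by simp [Tm.varOcc] at h
  | .out y t, h => by
    obtain ⟨D, rfl⟩ := exists_fill_var_of_varOcc_pos x t h
    exact ⟨.out y D, rfl⟩
  | .out2 y z t, h => by
    obtain ⟨D, rfl⟩ := exists_fill_var_of_varOcc_pos x t h
    exact ⟨.out2 y z D, rfl⟩
  | .close t, h => by
    obtain ⟨D, rfl⟩ := exists_fill_var_of_varOcc_pos x t h
    exact ⟨.close D, rfl⟩
  | .var y, h => by
    by_cases hy : y = x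
    · exact ⟨.hole, by rw [hy]; rfl⟩
    · simp [Tm.varOcc, hy] at h
  | .par s t, h => by
    rcases Nat.add_pos_iff_pos_or_pos.mp h with h | h
    · obtain ⟨D, rfl⟩ := exists_fill_var_of_varOcc_pos x s h
      exact ⟨.parL D t, rfl⟩
    · obtain ⟨D, rfl⟩ := exists_fill_var_of_varOcc_pos x t h
      exact ⟨.parR s D, rfl⟩
  | .app s t, h => by
    rcases Nat.add_pos_iff_pos_or_pos.mp h with h | h
    · obtain ⟨D, rfl⟩ := exists_fill_var_of_varOcc_pos x s h
      exact ⟨.appL D t, rfl⟩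
    · obtain ⟨D, rfl⟩ := exists_fill_var_of_varOcc_pos x t h
      exact ⟨.appR s D, rfl⟩

theorem HasOutput.reducible_par {x : ℕ} {s t : Tm} (hs : HasOutput x s)
    (ht : 0 < Tm.varOcc x t) : Reducible (Tm.par s t) := by
  obtain ⟨C, u, v, rfl⟩ := hs
  obtain ⟨D, rfl⟩ := exists_fill_var_of_varOcc_pos x t ht
  exact ⟨_, Step.comm1 C D x u v⟩

theorem HasOutput.reducible_par' {x : ℕ} {s t : Tm} (ht : HasOutput x t)
    (hs : 0 < Tm.varOcc x s) : Reducible (Tm.par s t) := by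
  obtain ⟨C, u, v, rfl⟩ := ht
  obtain ⟨D, rfl⟩ := exists_fill_var_of_varOcc_pos x s hs
  exact ⟨_, Step.comm2 D C x u v⟩

theorem HasOutput.par_left {x : ℕ} {s : Tm} (t : Tm) (hs : HasOutput x s) :
    HasOutput x (Tm.par s t) := by
  obtain ⟨C, u, v, rfl⟩ := hs
  exact ⟨.parL C t, u, v, rfl⟩

theorem HasOutput.of_var {x y : ℕ} (h : HasOutput x (Tm.var y)) : False := by
  obtain ⟨C, u, v, h⟩ := h
  cases C <;> cases h

theorem HasOutput.of_unit {x : ℕ} (h : HasOutput x Tm.unit) : False := by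
  obtain ⟨C, u, v, h⟩ := h
  cases C <;> cases h

theorem HasOutput.of_out {x y : ℕ} {t : Tm} (h : HasOutput x (Tm.out y t)) :
    HasOutput x t := by
  obtain ⟨C, u, v, h⟩ := h
  cases C <;> cases h
  exact ⟨_, _, _, rfl⟩

theorem HasOutput.of_out2 {x y z : ℕ} {t : Tm} (h : HasOutput x (Tm.out2 y z t)) :
    HasOutput x t := by
  obtain ⟨C, u, v, h⟩ := h
  cases C <;> cases h
  exact ⟨_, _, _, rfl⟩

theorem HasOutput.of_close {x : ℕ} {t : Tm} (h : HasOutput x (Tm.close t)) :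
    HasOutput x t := by
  obtain ⟨C, u, v, h⟩ := h
  cases C <;> cases h
  exact ⟨_, _, _, rfl⟩

theorem HasOutput.of_par {x : ℕ} {s t : Tm} (h : HasOutput x (Tm.par s t)) :
    HasOutput x s ∨ HasOutput x t := by
  obtain ⟨C, u, v, h⟩ := h
  cases C <;> cases h
  · exact .inl ⟨_, _, _, rfl⟩
  · exact .inr ⟨_, _, _, rfl⟩

theorem HasOutput.of_app {x : ℕ} {s t : Tm} (h : HasOutput x (Tm.app s t)) :
    (∃ u, s = Tm.out x u) ∨ HasOutput x s ∨ HasOutput x t := by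
  obtain ⟨C, u, v, h⟩ := h
  cases C <;> cases h
  · exact .inl ⟨_, rfl⟩
  · exact .inr (.inl ⟨_, _, _, rfl⟩)
  · exact .inr (.inr ⟨_, _, _, rfl⟩)

@[simp] theorem varOccM_cons (x : ℕ) (e : Entry) (Δ : Multiset Entry) :
    varOccM x (e ::ₘ Δ) = Tm.varOcc x e.1 + varOccM x Δ := by
  simp [varOccM]

@[simp] theorem varOccM_add (x : ℕ) (Δ Θ : Multiset Entry) :
    varOccM x (Δ + Θ) = varOccM x Δ + varOccM x Θ := by
  simp [varOccM]

theorem varOcc_le_varOccM (x : ℕ) {e : Entry} {Δ : Multiset Entry} (he : e ∈ Δ) :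
    Tm.varOcc x e.1 ≤ varOccM x Δ := by
  obtain ⟨Θ, rfl⟩ := Multiset.exists_cons_of_mem he
  simp

/-- In a derivable sequent, the variable of an output channel occurs on the right-hand side. -/
theorem NMLL.varOccM_pos_of_out {Γ : Multiset (ℕ × Ty)} {Δ : Multiset Entry} (d : NMLL Γ Δ)
    (x : ℕ) (u : Tm) : ∀ e ∈ Δ, e.1 = Tm.out x u → 0 < varOccM x Δ := by
  induction d with
  | ax y A => simp
  | limpI y A B t d hx ih =>
    simp only [Multiset.mem_cons, forall_eq_or_imp, varOccM_cons, Tm.out.injEq, Tm.varOcc]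
      at ih ⊢
    refine ⟨?_, ih.2⟩
    rintro ⟨rfl, -⟩
    rcases hx with hx | ⟨e, he, hx⟩
    · omega
    · have := varOcc_le_varOccM y he
      omega
  | limpE s t A B d₁ d₂ h ih₁ ih₂ =>
    simp only [Multiset.mem_cons, Multiset.mem_add, forall_eq_or_imp, varOccM_cons, varOccM_add,
      Tm.varOcc] at ih₁ ih₂ ⊢
    refine ⟨by simp, ?_⟩
    rintro e (he | he) hu
    · have := ih₁.2 e he hu
      omega
    · have := ih₂.2 e he hu
      omega
  | parrI s t A B d ih =>
    simp only [Multiset.mem_cons, forall_eq_or_imp, varOccM_cons, Tm.varOcc] at ih ⊢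
    refine ⟨by simp, fun e he hu => ?_⟩
    have := ih.2.2 e he hu
    omega
  | parrE s y z A B d₁ d₂ d₃ h₁₂ h₁₃ h₂₃ ih₁ ih₂ ih₃ =>
    simp only [Multiset.mem_cons, Multiset.mem_add, forall_eq_or_imp, varOccM_cons, varOccM_add,
      Tm.varOcc] at ih₁ ih₂ ih₃ ⊢
    refine ⟨by simp, ?_⟩
    rintro e ((he | he) | he) hu
    · have := ih₁.2 e he hu
      omega
    · have := ih₂ e he hu
      omega
    · have := ih₃ e he hu
      omega
  | botI d ih =>
    simp only [Multiset.mem_cons, forall_eq_or_imp, varOccM_cons, Tm.varOcc] at ih ⊢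
    refine ⟨by simp, fun e he hu => ?_⟩
    have := ih e he hu
    omega
  | botE t d ih =>
    simp only [Multiset.mem_cons, forall_eq_or_imp, varOccM_cons, Tm.varOcc] at ih ⊢
    exact ⟨by simp, ih.2⟩

/-- In a derivable sequent, a term containing an output with continuation along x either reduces
or x occurs in some other term of the sequent. -/
theorem NMLL.reducible_or_varOcc_lt {Γ : Multiset (ℕ × Ty)} {Δ : Multiset Entry} (d : NMLL Γ Δ)
    (x : ℕ) : ∀ e ∈ Δ, HasOutput x e.1 → Reducible e.1 ∨ Tm.varOcc x e.1 < varOccM x Δ := by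
  induction d with
  | ax y A =>
    intro e he h
    rw [Multiset.mem_singleton.mp he] at h
    exact h.of_var.elim
  | limpI y A B t d hx ih =>
    simp only [Multiset.mem_cons, forall_eq_or_imp, varOccM_cons, Tm.varOcc] at ih ⊢
    exact ⟨fun h => (ih.1 h.of_out).imp_left (Reducible.fill (.out y .hole)), ih.2⟩
  | limpE s t A B d₁ d₂ h ih₁ ih₂ =>
    have hout := fun u => d₁.varOccM_pos_of_out x u _ (Multiset.mem_cons_self _ _)
    simp only [Multiset.mem_cons, Multiset.mem_add, forall_eq_or_imp, varOccM_cons, varOccM_add,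
      Tm.varOcc] at hout ih₁ ih₂ ⊢
    refine ⟨fun h => ?_, ?_⟩
    · rcases h.of_app with ⟨u, rfl⟩ | h | h
      · have hpos := hout u rfl
        simp only [Tm.varOcc] at hpos ⊢
        rcases Nat.eq_zero_or_pos (Tm.varOcc x u) with hu | hu
        · right
          omega
        · exact .inl ⟨_, Step.beta x u t hu⟩
      · exact (ih₁.1 h).imp (Reducible.fill (.appL .hole t)) (by omega)
      · exact (ih₂.1 h).imp (Reducible.fill (.appR s .hole)) (by omega)
    · rintro e (he | he) h
      · exact (ih₁.2 e he h).imp_right (by omega)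
      · exact (ih₂.2 e he h).imp_right (by omega)
  | parrI s t A B d ih =>
    simp only [Multiset.mem_cons, forall_eq_or_imp, varOccM_cons, Tm.varOcc] at ih ⊢
    refine ⟨fun h => ?_, fun e he h => (ih.2.2 e he h).imp_right (by omega)⟩
    rcases h.of_par with h | h
    · rcases ih.1 h with hr | hlt
      · exact .inl (hr.fill (.parL .hole t))
      · rcases Nat.eq_zero_or_pos (Tm.varOcc x t) with ht | ht
        · right
          omega
        · exact .inl (h.reducible_par ht)
    · rcases ih.2.1 h with hr | hlt
      · exact .inl (hr.fill (.parR s .hole))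
      · rcases Nat.eq_zero_or_pos (Tm.varOcc x s) with hs | hs
        · right
          omega
        · exact .inl (h.reducible_par' hs)
  | parrE s y z A B d₁ d₂ d₃ h₁₂ h₁₃ h₂₃ ih₁ ih₂ ih₃ =>
    simp only [Multiset.mem_cons, Multiset.mem_add, forall_eq_or_imp, varOccM_cons, varOccM_add,
      Tm.varOcc] at ih₁ ih₂ ih₃ ⊢
    refine ⟨fun h => (ih₁.1 h.of_out2).imp (Reducible.fill (.out2 y z .hole)) (by omega), ?_⟩
    rintro e ((he | he) | he) h
    · exact (ih₁.2 e he h).imp_right (by omega)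
    · exact (ih₂ e he h).imp_right (by omega)
    · exact (ih₃ e he h).imp_right (by omega)
  | botI d ih =>
    simp only [Multiset.mem_cons, forall_eq_or_imp, varOccM_cons, Tm.varOcc] at ih ⊢
    exact ⟨fun h => h.of_unit.elim, fun e he h => (ih e he h).imp_right (by omega)⟩
  | botE t d ih =>
    simp only [Multiset.mem_cons, forall_eq_or_imp, varOccM_cons, Tm.varOcc] at ih ⊢
    exact ⟨fun h => (ih.1 h.of_close).imp_left (Reducible.fill (.close .hole)), ih.2⟩

theorem Reducible.foldl_par (ts : List Tm) : ∀ {t : Tm}, Reducible t →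
    Reducible (ts.foldl Tm.par t) := by
  induction ts with
  | nil => exact id
  | cons a ts ih => exact fun h => ih (h.fill (.parL .hole a))

theorem HasOutput.reducible_foldl_par {x : ℕ} (δ : List Entry) : ∀ {t : Tm}, HasOutput x t →
    0 < varOccM x (δ : Multiset Entry) → Reducible ((δ.map Prod.fst).foldl Tm.par t) := by
  induction δ with
  | nil => simp [varOccM]
  | cons e δ ih =>
    intro t ht hpos
    rw [← Multiset.cons_coe, varOccM_cons] at hpos
    rcases Nat.eq_zero_or_pos (Tm.varOcc x e.1) with he | he
    · exact ih (ht.par_left e.1) (by omega)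
    · exact (ht.reducible_par he).foldl_par _

/-- Progress for channels with continuation. -/
theorem progress_output_with_continuation {Γ : Multiset (ℕ × Ty)} {F : Ty}
    (C : Ctx) (x : ℕ) (u v : Tm) (δ : List Entry)
    (d : NMLL Γ ((C.fill (Tm.app (Tm.out x u) v), some F) ::ₘ (↑δ : Multiset Entry))) :
    ¬ NormalTm (bigPar (C.fill (Tm.app (Tm.out x u) v) :: δ.map Prod.fst)) := by
  have hC : HasOutput x (C.fill (Tm.app (Tm.out x u) v)) := ⟨C, u, v, rfl⟩
  have hred : Reducible (bigPar (C.fill (Tm.app (Tm.out x u) v) :: δ.map Prod.fst)) := by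
    rcases d.reducible_or_varOcc_lt x _ (Multiset.mem_cons_self _ _) hC with h | h
    · exact h.foldl_par _
    · rw [varOccM_cons] at h
      exact hC.reducible_foldl_par δ (by omega)
  obtain ⟨w, hw⟩ := hred
  exact fun hn => hn w hw
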